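/- arXiv:1509.01652 — 7 statements merged into one kernel-verified Lean document; each statement's English description precedes it below -/
import Mathlib

section
/- Let (Ω, ℱ, ℙ) be a probability space, S a finite nonempty type, T a finite set of real numbers, X : Ω → S a measurable random variable, and for each m ∈ S let Y_m : Ω → ℝ be a measurable random variable with ℙ(Y_m ∈ T) = 1. Define γ = E[ω ↦ Y_{X(ω)}(ω)], so that γ = Σ_{m∈S, y∈T} y · ℙ(Y_m = y and X = m). Then L ≤ γ ≤ U, where L = Σ_{m∈S, y∈T} y · ( max(0, ℙ(X = m) + ℙ(Y_m = y) − 1) · 1{y > 0} + min(ℙ(X = m), ℙ(Y_m = y)) · 1{y < 0} ) and U = Σ_{m∈S, y∈T} y · ( max(0, ℙ(X = m) + ℙ(Y_m = y) − 1) · 1{y < 0} + min(ℙ(X = m), ℙ(Y_m = y)) · 1{y > 0} ). -/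
open MeasureTheory

/-- Theorem 1 (core probabilistic bound): for a discrete "mediator" `X` and
"outcome" variables `Y m` supported on a finite set `T` of reals, the
cross-world mean `γ = E[Y_{X}]` satisfies the Fréchet–Hoeffding-type bounds
`L ≤ γ ≤ U`, which depend only on the marginals of `X` and of each `Y m`. -/
theorem stmt0 {Ω : Type*} [MeasurableSpace Ω] (P : Measure Ω) [IsProbabilityMeasure P]
    {S : Type*} [Fintype S] [Nonempty S] [MeasurableSpace S] [MeasurableSingletonClass S]
    (T : Finset ℝ)
    (X : Ω → S) (hX : Measurable X)
    (Y : S → Ω → ℝ) (hY : ∀ m, Measurable (Y m))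
    (hT : ∀ m, P {ω | Y m ω ∈ (T : Set ℝ)} = 1)
    (γ L U : ℝ)
    (hγ : γ = ∫ ω, Y (X ω) ω ∂P)
    (hL : L = ∑ m : S, ∑ y ∈ T, y *
      (max 0 ((P {ω | X ω = m}).toReal + (P {ω | Y m ω = y}).toReal - 1) *
        (if 0 < y then (1 : ℝ) else 0) +
       min (P {ω | X ω = m}).toReal (P {ω | Y m ω = y}).toReal *
        (if y < 0 then (1 : ℝ) else 0)))
    (hU : U = ∑ m : S, ∑ y ∈ T, y *
      (max 0 ((P {ω | X ω = m}).toReal + (P {ω | Y m ω = y}).toReal - 1) *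
        (if y < 0 then (1 : ℝ) else 0) +
       min (P {ω | X ω = m}).toReal (P {ω | Y m ω = y}).toReal *
        (if 0 < y then (1 : ℝ) else 0))) :
    γ = (∑ m : S, ∑ y ∈ T, y * (P {ω | Y m ω = y ∧ X ω = m}).toReal) ∧
    L ≤ γ ∧ γ ≤ U := by
  classical
  have mX : ∀ m, MeasurableSet {ω | X ω = m} := fun m => hX (measurableSet_singleton m)
  have mY : ∀ m y, MeasurableSet {ω | Y m ω = y} := fun m y => hY m (measurableSet_singleton y)
  have mYX : ∀ m y, MeasurableSet {ω | Y m ω = y ∧ X ω = m} := fun m y => (mY m y).inter (mX m)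
  have hae : ∀ᵐ ω ∂P, ∀ m, Y m ω ∈ T := by
    rw [ae_all_iff]
    intro m
    have hm : MeasurableSet {ω | Y m ω ∈ (T : Set ℝ)} := hY m T.measurableSet
    have := (prob_compl_eq_zero_iff hm).2 (hT m)
    rw [ae_iff]
    exact this
  have key : γ = (∑ m : S, ∑ y ∈ T, y * (P {ω | Y m ω = y ∧ X ω = m}).toReal) := by
    have e : (fun ω => Y (X ω) ω) =ᵐ[P] fun ω => ∑ m : S, ∑ y ∈ T,
        Set.indicator {ω | Y m ω = y ∧ X ω = m} (fun _ => y) ω := by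
      filter_upwards [hae] with ω hω
      rw [Finset.sum_eq_single (X ω), Finset.sum_eq_single (Y (X ω) ω)]
      · simp
      · intro y _ hy
        simp [Set.indicator, hy.symm]
      · intro h
        exact absurd (hω _) h
      · intro m _ hm
        apply Finset.sum_eq_zero
        intro y _
        simp [Set.indicator, hm.symm]
      · simp
    have hi : ∀ m y, Integrable (Set.indicator {ω | Y m ω = y ∧ X ω = m} (fun _ => y)) P :=
      fun m y => (integrable_const y).indicator (mYX m y)
    rw [hγ, integral_congr_ae e, integral_finset_sum _ (fun m _ => integrable_finset_sum _ (fun y _ => hi m y))]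
    refine Finset.sum_congr rfl fun m _ => ?_
    rw [integral_finset_sum _ (fun y _ => hi m y)]
    refine Finset.sum_congr rfl fun y _ => ?_
    rw [integral_indicator_const _ (mYX m y), smul_eq_mul, mul_comm]
    rfl
  have up : ∀ m y, (P {ω | Y m ω = y ∧ X ω = m}).toReal ≤
      min (P {ω | X ω = m}).toReal (P {ω | Y m ω = y}).toReal := fun m y =>
    le_min (measureReal_mono (μ := P) (fun _ h => h.2)) (measureReal_mono (μ := P) (fun _ h => h.1))
  have lo : ∀ m y, max 0 ((P {ω | X ω = m}).toReal + (P {ω | Y m ω = y}).toReal - 1) ≤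
      (P {ω | Y m ω = y ∧ X ω = m}).toReal := by
    intro m y
    refine max_le ENNReal.toReal_nonneg ?_
    have h1 := measureReal_union_add_inter (μ := P) (s := {ω | Y m ω = y}) (mX m)
    have h2 : P.real ({ω | Y m ω = y} ∪ {ω | X ω = m}) ≤ 1 := measureReal_le_one
    have h3 : {ω | Y m ω = y} ∩ {ω | X ω = m} = {ω | Y m ω = y ∧ X ω = m} := rfl
    rw [h3] at h1
    simp only [Measure.real] at h1 h2
    linarith
  refine ⟨key, ?_, ?_⟩
  · rw [key, hL]
    refine Finset.sum_le_sum fun m _ => Finset.sum_le_sum fun y _ => ?_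
    rcases lt_trichotomy y 0 with h | h | h
    · simpa only [h, h.not_gt, if_true, if_false, mul_zero, mul_one, zero_add] using
        mul_le_mul_of_nonpos_left (up m y) h.le
    · simp [h]
    · simpa only [h, h.not_gt, if_true, if_false, mul_zero, mul_one, add_zero] using
        mul_le_mul_of_nonneg_left (lo m y) h.le
  · rw [key, hU]
    refine Finset.sum_le_sum fun m _ => Finset.sum_le_sum fun y _ => ?_
    rcases lt_trichotomy y 0 with h | h | h
    · simpa only [h, h.not_gt, if_true, if_false, mul_zero, mul_one, add_zero] using
        mul_le_mul_of_nonpos_left (lo m y) h.le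
    · simp [h]
    · simpa only [h, h.not_gt, if_true, if_false, mul_zero, mul_one, zero_add] using
        mul_le_mul_of_nonneg_left (up m y) h.le
end

section
/- Let (Ω, ℱ, ℙ) be a probability space, S a finite nonempty type, T a finite set of real numbers, X : Ω → S a measurable random variable, and for each m ∈ S let Y_m : Ω → ℝ be a measurable random variable with ℙ(Y_m ∈ T) = 1. Define L = Σ_{m∈S, y∈T} y · ( max(0, ℙ(X = m) + ℙ(Y_m = y) − 1) · 1{y > 0} + min(ℙ(X = m), ℙ(Y_m = y)) · 1{y < 0} ) and U = Σ_{m∈S, y∈T} y · ( max(0, ℙ(X = m) + ℙ(Y_m = y) − 1) · 1{y < 0} + min(ℙ(X = m), ℙ(Y_m = y)) · 1{y > 0} ). If for every m ∈ S there exists y_m ∈ T with ℙ(Y_m = y_m) = 1 (i.e., each Y_m is almost surely degenerate), then L = U. -/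
open MeasureTheory

/-- The lower and upper bounds of Theorem 1 coincide when each counterfactual
outcome `Y m` is almost surely degenerate. -/
theorem stmt1 {Ω : Type*} [MeasurableSpace Ω] (P : Measure Ω) [IsProbabilityMeasure P]
    {S : Type*} [Fintype S] [Nonempty S] [MeasurableSpace S] [MeasurableSingletonClass S]
    (T : Finset ℝ)
    (X : Ω → S) (hX : Measurable X)
    (Y : S → Ω → ℝ) (hY : ∀ m, Measurable (Y m))
    (hT : ∀ m, P {ω | Y m ω ∈ (T : Set ℝ)} = 1)
    (L U : ℝ)
    (hL : L = ∑ m : S, ∑ y ∈ T, y *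
      (max 0 ((P {ω | X ω = m}).toReal + (P {ω | Y m ω = y}).toReal - 1) *
        (if 0 < y then (1 : ℝ) else 0) +
       min (P {ω | X ω = m}).toReal (P {ω | Y m ω = y}).toReal *
        (if y < 0 then (1 : ℝ) else 0)))
    (hU : U = ∑ m : S, ∑ y ∈ T, y *
      (max 0 ((P {ω | X ω = m}).toReal + (P {ω | Y m ω = y}).toReal - 1) *
        (if y < 0 then (1 : ℝ) else 0) +
       min (P {ω | X ω = m}).toReal (P {ω | Y m ω = y}).toReal *
        (if 0 < y then (1 : ℝ) else 0)))
    (hdeg : ∀ m : S, ∃ y ∈ T, P {ω | Y m ω = y} = 1) :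
    L = U := by
  rw [hL, hU]
  refine Finset.sum_congr rfl fun m _ => Finset.sum_congr rfl fun y _ => ?_
  have hp0 : 0 ≤ (P {ω | X ω = m}).toReal := ENNReal.toReal_nonneg
  have hp1 : (P {ω | X ω = m}).toReal ≤ 1 := by
    have h := ENNReal.toReal_mono ENNReal.one_ne_top (prob_le_one (μ := P) (s := {ω | X ω = m}))
    simpa using h
  have key : max 0 ((P {ω | X ω = m}).toReal + (P {ω | Y m ω = y}).toReal - 1) =
      min (P {ω | X ω = m}).toReal (P {ω | Y m ω = y}).toReal := by
    obtain ⟨z, _, hz⟩ := hdeg m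
    by_cases hyz : y = z
    · subst hyz
      rw [hz, ENNReal.toReal_one, min_eq_left hp1, max_eq_right (by linarith)]
      ring
    · have hms : MeasurableSet {ω | Y m ω = z} := hY m (measurableSet_singleton z)
      have h0 : P {ω | Y m ω = y} = 0 := by
        refine measure_mono_null ?_ ((prob_compl_eq_zero_iff hms).2 hz)
        intro ω hω hω2
        exact hyz (Eq.trans (Eq.symm hω) hω2)
      rw [h0, ENNReal.toReal_zero, min_eq_right hp0, max_eq_left (by linarith)]
  rw [key]
  ring
end

section
/- Let (Ω, ℱ, ℙ) be a probability space, S a finite nonempty type, T a finite set of real numbers, X : Ω → S a measurable random variable, and for each m ∈ S let Y_m : Ω → ℝ be a measurable random variable with ℙ(Y_m ∈ T) = 1. Define L = Σ_{m∈S, y∈T} y · ( max(0, ℙ(X = m) + ℙ(Y_m = y) − 1) · 1{y > 0} + min(ℙ(X = m), ℙ(Y_m = y)) · 1{y < 0} ) and U = Σ_{m∈S, y∈T} y · ( max(0, ℙ(X = m) + ℙ(Y_m = y) − 1) · 1{y < 0} + min(ℙ(X = m), ℙ(Y_m = y)) · 1{y > 0} ). If there exists m₀ ∈ S with ℙ(X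 = m₀) = 1 (i.e., X is almost surely degenerate), then L = U. -/
open MeasureTheory

/-- The lower and upper bounds of Theorem 1 coincide when the counterfactual
mediator `X` is almost surely degenerate. -/
theorem stmt2 {Ω : Type*} [MeasurableSpace Ω] (P : Measure Ω) [IsProbabilityMeasure P]
    {S : Type*} [Fintype S] [Nonempty S] [MeasurableSpace S] [MeasurableSingletonClass S]
    (T : Finset ℝ)
    (X : Ω → S) (hX : Measurable X)
    (Y : S → Ω → ℝ) (hY : ∀ m, Measurable (Y m))
    (hT : ∀ m, P {ω | Y m ω ∈ (T : Set ℝ)} = 1)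
    (L U : ℝ)
    (hL : L = ∑ m : S, ∑ y ∈ T, y *
      (max 0 ((P {ω | X ω = m}).toReal + (P {ω | Y m ω = y}).toReal - 1) *
        (if 0 < y then (1 : ℝ) else 0) +
       min (P {ω | X ω = m}).toReal (P {ω | Y m ω = y}).toReal *
        (if y < 0 then (1 : ℝ) else 0)))
    (hU : U = ∑ m : S, ∑ y ∈ T, y *
      (max 0 ((P {ω | X ω = m}).toReal + (P {ω | Y m ω = y}).toReal - 1) *
        (if y < 0 then (1 : ℝ) else 0) +
       min (P {ω | X ω = m}).toReal (P {ω | Y m ω = y}).toReal *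
        (if 0 < y then (1 : ℝ) else 0)))
    (hdeg : ∃ m₀ : S, P {ω | X ω = m₀} = 1) :
    L = U := by
  obtain ⟨m₀, h₀⟩ := hdeg
  rw [hL, hU]
  refine Finset.sum_congr rfl fun m _ => Finset.sum_congr rfl fun y _ => ?_
  have hq0 : 0 ≤ (P {ω | Y m ω = y}).toReal := ENNReal.toReal_nonneg
  have hq1 : (P {ω | Y m ω = y}).toReal ≤ 1 := by
    have h := ENNReal.toReal_mono ENNReal.one_ne_top
      (prob_le_one (μ := P) (s := {ω | Y m ω = y}))
    simpa using h
  have hp : (P {ω | X ω = m}).toReal = 0 ∨ (P {ω | X ω = m}).toReal = 1 := by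
    by_cases hm : m = m₀
    · right
      rw [hm, h₀]
      simp
    · left
      have hms : MeasurableSet {ω | X ω = m₀} := hX (measurableSet_singleton m₀)
      have hc : P {ω | X ω = m₀}ᶜ = 0 := (prob_compl_eq_zero_iff hms).2 h₀
      have hz : P {ω | X ω = m} = 0 := by
        refine measure_mono_null ?_ hc
        intro ω hω hω'
        exact hm (hω.symm.trans hω')
      rw [hz]
      simp
  have key : max 0 ((P {ω | X ω = m}).toReal + (P {ω | Y m ω = y}).toReal - 1) =
      min (P {ω | X ω = m}).toReal (P {ω | Y m ω = y}).toReal := by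
    rcases hp with hp | hp
    · rw [hp, min_eq_left hq0, max_eq_left (by linarith)]
    · rw [hp, min_eq_right hq1, max_eq_right (by linarith)]
      ring
  rw [key]
  ring
end

section
/- Given probability mass functions μ on a finite type S and ν on a finite type T, a coupling of μ and ν is a function π : S × T → ℝ with π(s, t) ≥ 0 for all (s, t), Σ_{s,t} π(s, t) = 1, Σ_t π(s, t) = μ(s) for all s, and Σ_s π(s, t) = ν(t) for all t. Let α, β ∈ [0, 1], let μ be the probability mass function on Bool with μ(true) = α, and ν the probability mass function on Bool with ν(true) = β. For t ∈ ℝ define h_t : Bool × Bool → ℝ by h_t(true, true) = t, h_t(true, false) = α − t, h_t(false, true) = β − t, h_t(false, false) = 1 − α − β + t. Set t_L = max(0, α + β − 1) and t_U = min(α, β). Then for every coupling π of μ and ν and every function x : Bool × Bool → ℝ, the value Σ_{r,r*} x(r, r*) π(r, r*) satisfies min(Σ_{r,r*} x(r, r*) h_{t_L}(r, r*), Σ_{r,r*} x(r, r*) h_{t_U}(r, r*)) ≤ Σ_{r,r*} x(r, r*) π(r, r*) ≤ max(Σ_{r,r*} x(r, r*) h_{t_L}(r, r*), Σ_{r,r*}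 x(r, r*) h_{t_U}(r, r*)). -/
/-- A probability mass function on a finite type. -/
def IsPMF {S : Type*} [Fintype S] (μ : S → ℝ) : Prop :=
  (∀ s, 0 ≤ μ s) ∧ ∑ s, μ s = 1

/-- A coupling of two probability mass functions on finite types. -/
def IsCoupling {S T : Type*} [Fintype S] [Fintype T]
    (μ : S → ℝ) (ν : T → ℝ) (π : S × T → ℝ) : Prop :=
  (∀ p : S × T, 0 ≤ π p) ∧ (∑ p : S × T, π p = 1) ∧
  (∀ s, ∑ t, π (s, t) = μ s) ∧ (∀ t, ∑ s, π (s, t) = ν t)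

/-- Corollary 2: for binary marginals, the value of any linear functional at a
coupling lies between its values at the two Fréchet endpoint couplings
`h t_L` and `h t_U`. -/
theorem stmt9 (α β : ℝ) (hα : 0 ≤ α ∧ α ≤ 1) (hβ : 0 ≤ β ∧ β ≤ 1)
    (μ ν : Bool → ℝ)
    (hμt : μ true = α) (hμf : μ false = 1 - α)
    (hνt : ν true = β) (hνf : ν false = 1 - β)
    (h : ℝ → Bool × Bool → ℝ)
    (hh : ∀ t : ℝ, h t (true, true) = t ∧ h t (true, false) = α - t ∧
      h t (false, true) = β - t ∧ h t (false, false) = 1 - α - β + t)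
    (tL tU : ℝ) (htL : tL = max 0 (α + β - 1)) (htU : tU = min α β) :
    ∀ π : Bool × Bool → ℝ, IsCoupling μ ν π → ∀ x : Bool × Bool → ℝ,
      min (∑ r : Bool, ∑ rs : Bool, x (r, rs) * h tL (r, rs))
          (∑ r : Bool, ∑ rs : Bool, x (r, rs) * h tU (r, rs)) ≤
        (∑ r : Bool, ∑ rs : Bool, x (r, rs) * π (r, rs)) ∧
      (∑ r : Bool, ∑ rs : Bool, x (r, rs) * π (r, rs)) ≤
        max (∑ r : Bool, ∑ rs : Bool, x (r, rs) * h tL (r, rs))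
            (∑ r : Bool, ∑ rs : Bool, x (r, rs) * h tU (r, rs)) := by
  intro π hπ x
  obtain ⟨hpos, -, h1, h2⟩ := hπ
  have a1 := h1 true
  have a2 := h1 false
  have b1 := h2 true
  have p1 := hpos (true, true)
  have p2 := hpos (true, false)
  have p3 := hpos (false, true)
  have p4 := hpos (false, false)
  simp only [Fintype.sum_bool] at a1 a2 b1
  obtain ⟨l1, l2, l3, l4⟩ := hh tL
  obtain ⟨u1, u2, u3, u4⟩ := hh tU
  have e2 : π (true, false) = α - π (true, true) := by linarith
  have e3 : π (false, true) = β - π (true, true) := by linarith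
  have e4 : π (false, false) = 1 - α - β + π (true, true) := by linarith
  have hL : tL ≤ π (true, true) := by
    rw [htL]; exact max_le p1 (by linarith)
  have hU : π (true, true) ≤ tU := by
    rw [htU]; exact le_min (by linarith) (by linarith)
  simp only [Fintype.sum_bool, l1, l2, l3, l4, u1, u2, u3, u4, e2, e3, e4]
  generalize π (true, true) = t at *
  rcases le_total 0 (x (true, true) - x (true, false) - x (false, true) + x (false, false)) with hc | hc
  · have k1 := mul_le_mul_of_nonneg_left hL hc
    have k2 := mul_le_mul_of_nonneg_left hU hc
    exact ⟨min_le_of_left_le (by linarith), le_max_of_le_right (by linarith)⟩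
  · have k1 := mul_le_mul_of_nonpos_left hL hc
    have k2 := mul_le_mul_of_nonpos_left hU hc
    exact ⟨min_le_of_right_le (by linarith), le_max_of_le_left (by linarith)⟩
end

section
/- Let (Ω, ℱ, ℙ) be a probability space, let E_R, E_M, E_Y be measurable spaces, and let ε_R : Ω → E_R, ε_M : Ω → E_M, ε_Y : Ω → E_Y be mutually independent random variables. Let 𝒜 be a type of exposure values, ℛ and ℳ finite types, and let g_R : 𝒜 × E_R → ℛ, g_M : 𝒜 × ℛ × E_M → ℳ be measurable and g_Y : 𝒜 × ℛ × ℳ × E_Y → ℝ be measurable with g_Y(ã, r, m, ε_Y) integrable for every ã, r, m. Fix a, a* ∈ 𝒜 and define the counterfactuals R(a) = g_R(a, ε_R), R(a*) = g_R(a*, ε_R), M(a*) = g_M(a*, R(a*), ε_M), and γ₀ = E[ g_Y(a, R(a), M(a*), ε_Y) ]. Then γ₀ = Σ_{r ∈ ℛ, r* ∈ ℛ} E[ g_Y(a, r, g_M(a*, r*, ε_M), ε_Y) ] · ℙ(R(a) = r and R(a*) = r*). -/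
open MeasureTheory ProbabilityTheory

/-- Representation (1) of γ₀ = E[Y{a, M(a*)}] under the nonparametric
structural equation model with mutually independent errors: it equals the sum
over cross-world confounder values `(r, r*)` of
`E[g_Y(a, r, g_M(a*, r*, ε_M), ε_Y)] · ℙ(R(a) = r, R(a*) = r*)`. -/
theorem stmt11 {Ω : Type*} [MeasurableSpace Ω] (P : Measure Ω) [IsProbabilityMeasure P]
    {ER EM EY : Type*} [MeasurableSpace ER] [MeasurableSpace EM] [MeasurableSpace EY]
    (εR : Ω → ER) (εM : Ω → EM) (εY : Ω → EY)
    (hεR : Measurable εR) (hεM : Measurable εM) (hεY : Measurable εY)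
    (hindep : iIndep ![MeasurableSpace.comap εR inferInstance,
                       MeasurableSpace.comap εM inferInstance,
                       MeasurableSpace.comap εY inferInstance] P)
    {𝒜 : Type*} [MeasurableSpace 𝒜]
    {ℛ ℳ : Type*} [Fintype ℛ] [Fintype ℳ]
    [MeasurableSpace ℛ] [MeasurableSingletonClass ℛ]
    [MeasurableSpace ℳ] [MeasurableSingletonClass ℳ]
    (gR : 𝒜 → ER → ℛ) (gM : 𝒜 → ℛ → EM → ℳ) (gY : 𝒜 → ℛ → ℳ → EY → ℝ)
    (hgR : Measurable fun q : 𝒜 × ER => gR q.1 q.2)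
    (hgM : Measurable fun q : 𝒜 × ℛ × EM => gM q.1 q.2.1 q.2.2)
    (hgY : Measurable fun q : 𝒜 × ℛ × ℳ × EY => gY q.1 q.2.1 q.2.2.1 q.2.2.2)
    (hint : ∀ (aa : 𝒜) (r : ℛ) (m : ℳ), Integrable (fun ω => gY aa r m (εY ω)) P)
    (a astar : 𝒜) :
    ∫ ω, gY a (gR a (εR ω)) (gM astar (gR astar (εR ω)) (εM ω)) (εY ω) ∂P =
    ∑ r : ℛ, ∑ rstar : ℛ,
      (∫ ω, gY a r (gM astar rstar (εM ω)) (εY ω) ∂P) *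
      (P {ω | gR a (εR ω) = r ∧ gR astar (εR ω) = rstar}).toReal := by
  classical
  have hind : IndepFun εR (fun ω => (εM ω, εY ω)) P := by
    have h := indep_iSup_of_disjoint (S := {0}) (T := {1, 2}) (m := ![MeasurableSpace.comap εR inferInstance,
                       MeasurableSpace.comap εM inferInstance,
                       MeasurableSpace.comap εY inferInstance]) (μ := P)
      (by intro i; fin_cases i
          · exact hεR.comap_le
          · exact hεM.comap_le
          · exact hεY.comap_le) hindep (by simp)
    rw [IndepFun_iff_Indep]
    have e : MeasurableSpace.comap (fun ω => (εM ω, εY ω)) inferInstance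
        = MeasurableSpace.comap εM inferInstance ⊔ MeasurableSpace.comap εY inferInstance := by
      exact MeasurableSpace.comap_prodMk εM εY
    rw [e]
    simpa [iSup_insert] using h
  have hZm : ∀ r s, Measurable (fun p : EM × EY => gY a r (gM astar s p.1) p.2) := by
    intro r s
    have h1 : Measurable (fun p : EM × EY => gM astar s p.1) :=
      hgM.comp (f := fun p : EM × EY => (astar, s, p.1)) (by fun_prop)
    exact hgY.comp (f := fun p : EM × EY => (a, r, gM astar s p.1, p.2)) (by fun_prop)
  have hZmΩ : ∀ r s, Measurable (fun ω => gY a r (gM astar s (εM ω)) (εY ω)) := fun r s =>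
    (hZm r s).comp (hεM.prodMk hεY)
  have hZi : ∀ r s, Integrable (fun ω => gY a r (gM astar s (εM ω)) (εY ω)) P := by
    intro r s
    have hb : Integrable (fun ω => ∑ m : ℳ, ‖gY a r m (εY ω)‖) P :=
      integrable_finsetSum _ (fun m _ => (hint a r m).norm)
    refine hb.mono' (hZmΩ r s).aestronglyMeasurable (Filter.Eventually.of_forall fun ω => ?_)
    exact Finset.single_le_sum (f := fun m => ‖gY a r m (εY ω)‖) (fun m _ => norm_nonneg _)
      (Finset.mem_univ (gM astar s (εM ω)))
  have hRm : ∀ b, Measurable (gR b) := fun b =>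
    hgR.comp (f := fun e : ER => (b, e)) (by fun_prop)
  have hS : ∀ r s, MeasurableSet {e : ER | gR a e = r ∧ gR astar e = s} := fun r s =>
    (hRm a (measurableSet_singleton r)).inter (hRm astar (measurableSet_singleton s))
  have hSΩ : ∀ r s, MeasurableSet {ω | gR a (εR ω) = r ∧ gR astar (εR ω) = s} := fun r s =>
    hεR (hS r s)
  have key : ∀ ω, gY a (gR a (εR ω)) (gM astar (gR astar (εR ω)) (εM ω)) (εY ω) =
      ∑ r : ℛ, ∑ s : ℛ, {ω | gR a (εR ω) = r ∧ gR astar (εR ω) = s}.indicator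
        (fun ω => gY a r (gM astar s (εM ω)) (εY ω)) ω := by
    intro ω
    rw [Finset.sum_eq_single (gR a (εR ω)), Finset.sum_eq_single (gR astar (εR ω))]
    · simp
    · intro s _ hs
      simp [hs.symm]
    · simp
    · intro r _ hr
      simp [hr.symm]
    · simp
  simp_rw [key]
  rw [integral_finsetSum _ (fun r _ => integrable_finsetSum _
    fun s _ => (hZi r s).indicator (hSΩ r s))]
  refine Finset.sum_congr rfl fun r _ => ?_
  rw [integral_finsetSum _ (fun s _ => (hZi r s).indicator (hSΩ r s))]
  refine Finset.sum_congr rfl fun s _ => ?_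
  have hφ : Measurable ({e : ER | gR a e = r ∧ gR astar e = s}.indicator (fun _ => (1:ℝ))) :=
    measurable_const.indicator (hS r s)
  have hi := hind.comp (φ := {e : ER | gR a e = r ∧ gR astar e = s}.indicator (fun _ => (1:ℝ)))
    hφ (hZm r s)
  have h := hi.integral_fun_mul_eq_mul_integral
    (hφ.comp hεR).aestronglyMeasurable
    (hZmΩ r s).aestronglyMeasurable
  have e1 : ∫ ω, ({e : ER | gR a e = r ∧ gR astar e = s}.indicator (fun _ => (1:ℝ)) ∘ εR) ω ∂P
      = (P {ω | gR a (εR ω) = r ∧ gR astar (εR ω) = s}).toReal :=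
    integral_indicator_one (hSΩ r s)
  rw [e1, mul_comm] at h
  refine Eq.trans ?_ h
  refine integral_congr_ae (Filter.Eventually.of_forall fun ω => ?_)
  simp [Set.indicator_apply]
end

section
/- Let (Ω, ℱ, ℙ) be a probability space, 𝒜 and ℳ finite types, T a finite set of real numbers, A : Ω → 𝒜 a random variable, and for each ã ∈ 𝒜 and m ∈ ℳ let M_ã : Ω → ℳ and Y_{ã,m} : Ω → ℝ be random variables with ℙ(Y_{ã,m} ∈ T) = 1. Define the observed mediator M(ω) = M_{A(ω)}(ω) and observed outcome Y(ω) = Y_{A(ω), M(ω)}(ω). Fix a, a* ∈ 𝒜 and assume: (randomization) for each m ∈ ℳ, the triple (M_a, M_{a*}, Y_{a,m}) is independent of A; (no mediator–outcome confounding given A = a) for each m, m' ∈ ℳ and y ∈ T, ℙ(Y_{a,m} = y and M_a = m' | A = a) = ℙ(Y_{a,m} = y | A = a) · ℙ(M_a = m' | A = a); (cross-world independence given A = a) for each m, m' ∈ ℳ and y ∈ T, ℙ(Y_{a,m} = y and M_{a*} = m' | A = a) = ℙ(Y_{a,m} = y | A = a) · ℙ(M_{a*} = m' | A = a); and (positivity)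 ℙ(A = a) > 0, ℙ(A = a*) > 0, and ℙ(M = m and A = a) > 0 for every m with ℙ(M_{a*} = m) > 0. Then E[ω ↦ Y_{a, M_{a*}(ω)}(ω)] = Σ_{m ∈ ℳ} E[Y | M = m, A = a] · ℙ(M = m | A = a*), where conditional expectations and probabilities are defined as ratios. -/
open MeasureTheory ProbabilityTheory

theorem aux_ae {Ω : Type*} [MeasurableSpace Ω] (P : Measure Ω) [IsProbabilityMeasure P]
    (T : Finset ℝ) (f : Ω → ℝ) (hf : Measurable f)
    (hT : P {ω | f ω ∈ (T : Set ℝ)} = 1) :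
    f =ᵐ[P] fun ω => ∑ y ∈ T, ({ω | f ω = y}).indicator (fun _ => y) ω := by
  have h : ∀ᵐ ω ∂P, f ω ∈ (T : Set ℝ) := by
    have hm : MeasurableSet {ω | f ω ∈ (T : Set ℝ)} := hf T.measurableSet
    exact (mem_ae_iff_prob_eq_one hm).2 hT
  filter_upwards [h] with ω hω
  rw [Finset.sum_eq_single (f ω)]
  · simp
  · intro b _ hb
    exact Set.indicator_of_notMem (fun h => hb h.symm) _
  · intro h; exact absurd hω h

theorem aux_int {Ω : Type*} [MeasurableSpace Ω] (P : Measure Ω) [IsProbabilityMeasure P]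
    (T : Finset ℝ) (f : Ω → ℝ) (hf : Measurable f)
    (hT : P {ω | f ω ∈ (T : Set ℝ)} = 1) : Integrable f P := by
  refine Integrable.congr ?_ (aux_ae P T f hf hT).symm
  exact integrable_finsetSum _ fun y _ =>
    (integrable_const y).indicator (hf (measurableSet_singleton y))

theorem aux_setInt {Ω : Type*} [MeasurableSpace Ω] (P : Measure Ω) [IsProbabilityMeasure P]
    (T : Finset ℝ) (f : Ω → ℝ) (hf : Measurable f)
    (hT : P {ω | f ω ∈ (T : Set ℝ)} = 1) (S : Set Ω) :
    ∫ ω in S, f ω ∂P = ∑ y ∈ T, (P ({ω | f ω = y} ∩ S)).toReal * y := by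
  rw [integral_congr_ae (ae_restrict_of_ae (aux_ae P T f hf hT)), integral_finsetSum]
  · refine Finset.sum_congr rfl fun y _ => ?_
    have hm : MeasurableSet {ω | f ω = y} := hf (measurableSet_singleton y)
    rw [integral_indicator_const _ hm, measureReal_def, Measure.restrict_apply hm, smul_eq_mul]
  · exact fun y _ => (integrable_const y).indicator (hf (measurableSet_singleton y))

/-- The mediation formula: under randomization, no mediator–outcome confounding
given `A = a`, cross-world independence given `A = a`, and positivity,
`E[Y_{a, M_{a*}}] = ∑ₘ E[Y | M = m, A = a] · ℙ(M = m | A = a*)`, with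
conditional expectations and probabilities defined as ratios. -/
theorem stmt12 {Ω : Type*} [MeasurableSpace Ω] (P : Measure Ω) [IsProbabilityMeasure P]
    {𝒜 ℳ : Type*} [Fintype 𝒜] [Fintype ℳ]
    [MeasurableSpace 𝒜] [MeasurableSingletonClass 𝒜]
    [MeasurableSpace ℳ] [MeasurableSingletonClass ℳ]
    (T : Finset ℝ)
    (A : Ω → 𝒜) (hA : Measurable A)
    (M : 𝒜 → Ω → ℳ) (hM : ∀ a0, Measurable (M a0))
    (Y : 𝒜 → ℳ → Ω → ℝ) (hY : ∀ a0 m, Measurable (Y a0 m))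
    (hT : ∀ a0 m, P {ω | Y a0 m ω ∈ (T : Set ℝ)} = 1)
    (a astar : 𝒜)
    (Mobs : Ω → ℳ) (hMobs : Mobs = fun ω => M (A ω) ω)
    (Yobs : Ω → ℝ) (hYobs : Yobs = fun ω => Y (A ω) (Mobs ω) ω)
    (hrand : ∀ m : ℳ, IndepFun (fun ω => (M a ω, M astar ω, Y a m ω)) A P)
    (hnoconf : ∀ (m m' : ℳ), ∀ y ∈ T,
      (P {ω | Y a m ω = y ∧ M a ω = m' ∧ A ω = a}).toReal /
        (P {ω | A ω = a}).toReal =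
      ((P {ω | Y a m ω = y ∧ A ω = a}).toReal / (P {ω | A ω = a}).toReal) *
      ((P {ω | M a ω = m' ∧ A ω = a}).toReal / (P {ω | A ω = a}).toReal))
    (hcrossworld : ∀ (m m' : ℳ), ∀ y ∈ T,
      (P {ω | Y a m ω = y ∧ M astar ω = m' ∧ A ω = a}).toReal /
        (P {ω | A ω = a}).toReal =
      ((P {ω | Y a m ω = y ∧ A ω = a}).toReal / (P {ω | A ω = a}).toReal) *
      ((P {ω | M astar ω = m' ∧ A ω = a}).toReal / (P {ω | A ω = a}).toReal))
    (hposa : 0 < P {ω | A ω = a}) (hposastar : 0 < P {ω | A ω = astar})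
    (hposm : ∀ m : ℳ, 0 < P {ω | M astar ω = m} →
      0 < P {ω | Mobs ω = m ∧ A ω = a}) :
    ∫ ω, Y a (M astar ω) ω ∂P =
    ∑ m : ℳ,
      ((∫ ω in {ω | Mobs ω = m ∧ A ω = a}, Yobs ω ∂P) /
        (P {ω | Mobs ω = m ∧ A ω = a}).toReal) *
      ((P {ω | Mobs ω = m ∧ A ω = astar}).toReal /
        (P {ω | A ω = astar}).toReal) := by
  classical
  have hp : (P {ω | A ω = a}).toReal ≠ 0 := (ENNReal.toReal_pos hposa.ne' (by simp)).ne'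
  have hps : (P {ω | A ω = astar}).toReal ≠ 0 :=
    (ENNReal.toReal_pos hposastar.ne' (by simp)).ne'
  have ind : ∀ (m : ℳ) (B : Set (ℳ × ℳ × ℝ)) (b : 𝒜), MeasurableSet B →
      (P {ω | (M a ω, M astar ω, Y a m ω) ∈ B ∧ A ω = b}).toReal =
        (P {ω | (M a ω, M astar ω, Y a m ω) ∈ B}).toReal * (P {ω | A ω = b}).toReal := by
    intro m B b hB
    rw [← ENNReal.toReal_mul]
    congr 1
    exact (hrand m).measure_inter_preimage_eq_mul B {b} hB (measurableSet_singleton b)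
  have m1 : ∀ m : ℳ, MeasurableSet {x : ℳ × ℳ × ℝ | x.1 = m} := fun m =>
    measurable_fst (measurableSet_singleton m)
  have m2 : ∀ m : ℳ, MeasurableSet {x : ℳ × ℳ × ℝ | x.2.1 = m} := fun m =>
    (measurable_fst.comp measurable_snd) (measurableSet_singleton m)
  have m3 : ∀ y : ℝ, MeasurableSet {x : ℳ × ℳ × ℝ | x.2.2 = y} := fun y =>
    (measurable_snd.comp measurable_snd) (measurableSet_singleton y)
  -- independence from `A`
  have iMa : ∀ m, (P {ω | M a ω = m ∧ A ω = a}).toReal =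
      (P {ω | M a ω = m}).toReal * (P {ω | A ω = a}).toReal := fun m => ind m _ a (m1 m)
  have iMs : ∀ m b, (P {ω | M astar ω = m ∧ A ω = b}).toReal =
      (P {ω | M astar ω = m}).toReal * (P {ω | A ω = b}).toReal := fun m b => ind m _ b (m2 m)
  have iY : ∀ m y, (P {ω | Y a m ω = y ∧ A ω = a}).toReal =
      (P {ω | Y a m ω = y}).toReal * (P {ω | A ω = a}).toReal := fun m y => ind m _ a (m3 y)
  have iYMs : ∀ m y, (P {ω | Y a m ω = y ∧ M astar ω = m ∧ A ω = a}).toReal =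
      (P {ω | Y a m ω = y ∧ M astar ω = m}).toReal * (P {ω | A ω = a}).toReal := by
    intro m y
    have := ind m _ a ((m3 y).inter (m2 m))
    simpa [and_assoc] using this
  have cw : ∀ m, ∀ y ∈ T, (P {ω | Y a m ω = y ∧ M astar ω = m}).toReal =
      (P {ω | Y a m ω = y}).toReal * (P {ω | M astar ω = m}).toReal := by
    intro m y hy
    have h := hcrossworld m m y hy
    rw [iYMs, iY, iMs] at h
    simpa [hp] using h
  have nc : ∀ m, ∀ y ∈ T, (P {ω | Y a m ω = y ∧ M a ω = m ∧ A ω = a}).toReal =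
      (P {ω | Y a m ω = y}).toReal * (P {ω | M a ω = m ∧ A ω = a}).toReal := by
    intro m y hy
    have h := hnoconf m m y hy
    rw [iY] at h
    field_simp at h
    linarith
  have setA : ∀ m b, {ω | Mobs ω = m ∧ A ω = b} = {ω | M b ω = m ∧ A ω = b} := by
    intro m b
    ext ω
    simp only [hMobs, Set.mem_setOf_eq]
    constructor
    · rintro ⟨h1, rfl⟩; exact ⟨h1, rfl⟩
    · rintro ⟨h1, rfl⟩; exact ⟨h1, rfl⟩
  have mMs : ∀ b m, MeasurableSet {ω | M b ω = m} := fun b m => hM b (measurableSet_singleton m)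
  have lhs : ∫ ω, Y a (M astar ω) ω ∂P = ∑ m, ∫ ω in {ω | M astar ω = m}, Y a m ω ∂P := by
    have : ∀ ω, Y a (M astar ω) ω = ∑ m, ({ω | M astar ω = m}).indicator (Y a m) ω := by
      intro ω
      rw [Finset.sum_eq_single (M astar ω)]
      · simp
      · intro b _ hb
        exact Set.indicator_of_notMem (fun h => hb h.symm) _
      · simp
    simp_rw [this]
    rw [integral_finsetSum]
    · exact Finset.sum_congr rfl fun m _ => integral_indicator (mMs astar m)
    · exact fun m _ => (aux_int P T _ (hY a m) (hT a m)).indicator (mMs astar m)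
  rw [lhs]
  refine Finset.sum_congr rfl fun m _ => ?_
  have e2 : ∫ ω in {ω | Mobs ω = m ∧ A ω = a}, Yobs ω ∂P =
      ∫ ω in {ω | M a ω = m ∧ A ω = a}, Y a m ω ∂P := by
    have hms : MeasurableSet {ω | M a ω = m ∧ A ω = a} :=
      (mMs a m).inter (hA (measurableSet_singleton a))
    rw [setA]
    refine setIntegral_congr_fun hms ?_
    rintro ω ⟨h1, h2⟩
    simp only [hYobs, hMobs, h2, h1]
  have hl : ∫ ω in {ω | M astar ω = m}, Y a m ω ∂P =
      (∑ y ∈ T, (P {ω | Y a m ω = y}).toReal * y) * (P {ω | M astar ω = m}).toReal := by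
    rw [aux_setInt P T _ (hY a m) (hT a m), Finset.sum_mul]
    refine Finset.sum_congr rfl fun y hy => ?_
    have := cw m y hy
    rw [← Set.setOf_and, this]; ring
  have hr : ∫ ω in {ω | M a ω = m ∧ A ω = a}, Y a m ω ∂P =
      (∑ y ∈ T, (P {ω | Y a m ω = y}).toReal * y) * (P {ω | M a ω = m ∧ A ω = a}).toReal := by
    rw [aux_setInt P T _ (hY a m) (hT a m), Finset.sum_mul]
    refine Finset.sum_congr rfl fun y hy => ?_
    have := nc m y hy
    rw [← Set.setOf_and, this]; ring
  rw [e2, hl, hr, setA m astar, iMs, mul_div_cancel_right₀ _ hps]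
  rcases eq_or_ne (P {ω | M astar ω = m}) 0 with h0 | h0
  · simp [h0]
  · have hpos := hposm m (pos_iff_ne_zero.2 h0)
    rw [setA] at hpos ⊢
    rw [mul_div_cancel_right₀ _ (ENNReal.toReal_pos hpos.ne' (by simp)).ne']
end

section
/- Let (Ω, ℱ, ℙ) be a probability space, 𝒜, ℛ, ℳ finite types, T a finite set of real numbers, A : Ω → 𝒜 a random variable, and for each ã ∈ 𝒜 and m ∈ ℳ let R_ã : Ω → ℛ, M_ã : Ω → ℳ, and Y_{ã,m} : Ω → ℝ be random variables with ℙ(Y_{ã,m} ∈ T) = 1. Define the observed variables R(ω) = R_{A(ω)}(ω), M(ω) = M_{A(ω)}(ω), and Y(ω) = Y_{A(ω), M(ω)}(ω). Fix a ∈ 𝒜, m ∈ ℳ, y ∈ T, and assume: (randomization) the triple (R_a, M_a, Y_{a,m}) is independent of A; (no mediator–outcome confounding given R_a) for every r ∈ ℛ with ℙ(R_a = r) > 0 and every m' ∈ ℳ, ℙ(Y_{a,m} = y and M_a = m' | R_a = r) = ℙ(Y_{a,m} = y | R_a = r) · ℙ(M_a = m' | R_a = r); and (positivity) ℙ(A =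 a) > 0 and ℙ(M = m and R = r and A = a) > 0 for every r with ℙ(R = r and A = a) > 0. Then ℙ(Y_{a,m} = y) = Σ_{r : ℙ(R = r and A = a) > 0} ℙ(Y = y | M = m, R = r, A = a) · ℙ(R = r | A = a), where conditional probabilities are defined as ratios. -/
open MeasureTheory ProbabilityTheory

/-- The g-formula identification step of Corollary 1 with an exposure-induced
confounder `R`: under randomization, no mediator–outcome confounding given
`R(a)`, and positivity, `ℙ(Y(a,m) = y)` is identified by
`∑_{r : ℙ(R = r, A = a) > 0} ℙ(Y = y | M = m, R = r, A = a) · ℙ(R = r | A = a)`,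
with conditional probabilities defined as ratios. -/
theorem stmt14 {Ω : Type*} [MeasurableSpace Ω] (P : Measure Ω) [IsProbabilityMeasure P]
    {𝒜 ℛ ℳ : Type*} [Fintype 𝒜] [Fintype ℛ] [Fintype ℳ]
    [MeasurableSpace 𝒜] [MeasurableSingletonClass 𝒜]
    [MeasurableSpace ℛ] [MeasurableSingletonClass ℛ]
    [MeasurableSpace ℳ] [MeasurableSingletonClass ℳ]
    (T : Finset ℝ)
    (A : Ω → 𝒜) (hA : Measurable A)
    (R : 𝒜 → Ω → ℛ) (hR : ∀ a0, Measurable (R a0))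
    (M : 𝒜 → Ω → ℳ) (hM : ∀ a0, Measurable (M a0))
    (Y : 𝒜 → ℳ → Ω → ℝ) (hY : ∀ a0 m, Measurable (Y a0 m))
    (hT : ∀ a0 m, P {ω | Y a0 m ω ∈ (T : Set ℝ)} = 1)
    (Robs : Ω → ℛ) (hRobs : Robs = fun ω => R (A ω) ω)
    (Mobs : Ω → ℳ) (hMobs : Mobs = fun ω => M (A ω) ω)
    (Yobs : Ω → ℝ) (hYobs : Yobs = fun ω => Y (A ω) (Mobs ω) ω)
    (a : 𝒜) (m : ℳ) (y : ℝ) (hy : y ∈ T)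
    (hrand : IndepFun (fun ω => (R a ω, M a ω, Y a m ω)) A P)
    (hnoconf : ∀ r : ℛ, 0 < P {ω | R a ω = r} → ∀ m' : ℳ,
      (P {ω | Y a m ω = y ∧ M a ω = m' ∧ R a ω = r}).toReal /
        (P {ω | R a ω = r}).toReal =
      ((P {ω | Y a m ω = y ∧ R a ω = r}).toReal / (P {ω | R a ω = r}).toReal) *
      ((P {ω | M a ω = m' ∧ R a ω = r}).toReal / (P {ω | R a ω = r}).toReal))
    (hposa : 0 < P {ω | A ω = a})
    (hposmr : ∀ r : ℛ, 0 < P {ω | Robs ω = r ∧ A ω = a} →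
      0 < P {ω | Mobs ω = m ∧ Robs ω = r ∧ A ω = a}) :
    (P {ω | Y a m ω = y}).toReal =
    ∑ r ∈ @Finset.filter ℛ (fun r => 0 < P {ω | Robs ω = r ∧ A ω = a})
        (Classical.decPred _) Finset.univ,
      ((P {ω | Yobs ω = y ∧ Mobs ω = m ∧ Robs ω = r ∧ A ω = a}).toReal /
        (P {ω | Mobs ω = m ∧ Robs ω = r ∧ A ω = a}).toReal) *
      ((P {ω | Robs ω = r ∧ A ω = a}).toReal / (P {ω | A ω = a}).toReal) := by
  have key : ∀ S : Set (ℛ × ℳ × ℝ), MeasurableSet S →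
      (P {ω | (R a ω, M a ω, Y a m ω) ∈ S ∧ A ω = a}).toReal =
        (P {ω | (R a ω, M a ω, Y a m ω) ∈ S}).toReal * (P {ω | A ω = a}).toReal := by
    intro S hS
    rw [← ENNReal.toReal_mul]
    exact congrArg _ (hrand.measure_inter_preimage_eq_mul S {a} hS (measurableSet_singleton a))
  have mR : ∀ r, MeasurableSet {p : ℛ × ℳ × ℝ | p.1 = r} := fun r =>
    measurable_fst (measurableSet_singleton r)
  have mM : MeasurableSet {p : ℛ × ℳ × ℝ | p.2.1 = m} :=
    (measurable_fst.comp measurable_snd) (measurableSet_singleton m)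
  have mY : MeasurableSet {p : ℛ × ℳ × ℝ | p.2.2 = y} :=
    (measurable_snd.comp measurable_snd) (measurableSet_singleton y)
  have e1 : ∀ r, (P {ω | Robs ω = r ∧ A ω = a}).toReal =
      (P {ω | R a ω = r}).toReal * (P {ω | A ω = a}).toReal := by
    intro r
    refine Eq.trans ?_ (key _ (mR r))
    congr 2
    ext ω
    simp only [hRobs, Set.mem_setOf_eq]
    constructor <;> rintro ⟨h1, h2⟩ <;> subst h2 <;> exact ⟨h1, rfl⟩
  have e2 : ∀ r, (P {ω | Mobs ω = m ∧ Robs ω = r ∧ A ω = a}).toReal =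
      (P {ω | M a ω = m ∧ R a ω = r}).toReal * (P {ω | A ω = a}).toReal := by
    intro r
    refine Eq.trans ?_ (key _ (mM.inter (mR r)))
    congr 2
    ext ω
    simp only [hRobs, hMobs, Set.mem_setOf_eq, Set.mem_inter_iff]
    constructor
    · rintro ⟨h0, h1, h2⟩
      subst h2
      exact ⟨⟨h0, h1⟩, rfl⟩
    · rintro ⟨⟨h0, h1⟩, h2⟩
      subst h2
      exact ⟨h0, h1, rfl⟩
  have e3 : ∀ r, (P {ω | Yobs ω = y ∧ Mobs ω = m ∧ Robs ω = r ∧ A ω = a}).toReal =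
      (P {ω | Y a m ω = y ∧ M a ω = m ∧ R a ω = r}).toReal * (P {ω | A ω = a}).toReal := by
    intro r
    refine Eq.trans ?_ (key _ (mY.inter (mM.inter (mR r))))
    congr 2
    ext ω
    simp only [hRobs, hMobs, hYobs, Set.mem_setOf_eq, Set.mem_inter_iff]
    constructor
    · rintro ⟨h, h0, h1, h2⟩
      subst h2
      rw [h0] at h
      exact ⟨⟨h, h0, h1⟩, rfl⟩
    · rintro ⟨⟨h, h0, h1⟩, h2⟩
      subst h2
      refine ⟨?_, h0, h1, rfl⟩
      rw [h0]
      exact h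
  have pa : 0 < (P {ω | A ω = a}).toReal := ENNReal.toReal_pos hposa.ne' (measure_ne_top _ _)
  have tot : (P {ω | Y a m ω = y}).toReal =
      ∑ r : ℛ, (P {ω | Y a m ω = y ∧ R a ω = r}).toReal := by
    rw [← ENNReal.toReal_sum (fun _ _ => measure_ne_top _ _)]
    congr 1
    have h := sum_measure_preimage_singleton (μ := P.restrict {ω | Y a m ω = y})
      (Finset.univ : Finset ℛ) (f := R a) (fun r _ => hR a (measurableSet_singleton r))
    rw [Finset.coe_univ, Set.preimage_univ, Measure.restrict_apply_univ] at h
    rw [← h]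
    refine Finset.sum_congr rfl fun r _ => ?_
    rw [Measure.restrict_apply (hR a (measurableSet_singleton r)), Set.inter_comm]
    rfl
  classical
  rw [tot, ← Finset.sum_subset (Finset.subset_univ
    (@Finset.filter ℛ (fun r => 0 < P {ω | Robs ω = r ∧ A ω = a})
        (Classical.decPred _) Finset.univ))]
  · refine Finset.sum_congr rfl fun r hr => ?_
    have hr' : 0 < P {ω | Robs ω = r ∧ A ω = a} := by simpa using hr
    have p1 := ENNReal.toReal_pos hr'.ne' (measure_ne_top _ _)
    have p2 := ENNReal.toReal_pos (hposmr r hr').ne' (measure_ne_top _ _)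
    rw [e1] at p1
    rw [e2] at p2
    have q1 := pos_of_mul_pos_left p1 pa.le
    have q2 := pos_of_mul_pos_left p2 pa.le
    have hc := hnoconf r (ENNReal.toReal_pos_iff.1 q1).1 m
    rw [e1, e2, e3]
    field_simp at hc ⊢
    linarith
  · intro r _ hr
    have hr' : P {ω | Robs ω = r ∧ A ω = a} = 0 := by simpa using hr
    have h1 := e1 r
    rw [hr', ENNReal.toReal_zero] at h1
    have h2 : (P {ω | R a ω = r}).toReal = 0 := by
      rcases mul_eq_zero.1 h1.symm with h | h
      · exact h
      · exact absurd h pa.ne'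
    have h3 : P {ω | R a ω = r} = 0 := by
      rcases (ENNReal.toReal_eq_zero_iff _).1 h2 with h | h
      · exact h
      · exact absurd h (measure_ne_top _ _)
    rw [measure_mono_null (fun ω h => h.2) h3, ENNReal.toReal_zero]
end
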